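/- Let X be a Banach space over ℝ or ℂ and T : X → X a bounded linear operator. Suppose X = M ⊕ N where M and N are closed T-invariant linear subspaces of X. Then T is chain transitive if and only if both restrictions T|_M and T|_N are chain transitive. -/

import Mathlib

/-- An `ε`-chain of `T` from `x` to `y`: a finite sequence `x = c 0, c 1, …, c n = y`
with `n ≥ 1` such that `‖T (c i) - c (i+1)‖ < ε` for every `0 ≤ i < n`. -/
def EpsChain {E : Type*} [NormedAddCommGroup E] (T : E → E) (ε : ℝ) (x y : E) : Prop :=
  ∃ (n : ℕ) (c : ℕ → E), 1 ≤ n ∧ c 0 = x ∧ c n = y ∧ ∀ i < n, ‖T (c i) - c (i + 1)‖ < ε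

/-- `x` is a chain recurrent point of `T` if for every `ε > 0` there is an `ε`-chain
beginning and ending at `x`. -/
def ChainRecurrent {E : Type*} [NormedAddCommGroup E] (T : E → E) (x : E) : Prop :=
  ∀ ε > 0, EpsChain T ε x x

theorem EpsChain.map {E F : Type*} [NormedAddCommGroup E] [NormedAddCommGroup F]
    {T : E → E} {S : F → F} {P : E → F} {K ε δ : ℝ} (hK : 0 < K) (hδ : K * δ ≤ ε)
    (hP : ∀ x y, ‖P x - P y‖ ≤ K * ‖x - y‖) (hPT : ∀ x, P (T x) = S (P x)) {x y : E}
    (h : EpsChain T δ x y) : EpsChain S ε (P x) (P y) := by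
  obtain ⟨n, c, hn, rfl, rfl, hc⟩ := h
  refine ⟨n, P ∘ c, hn, rfl, rfl, fun i hi => ?_⟩
  calc ‖S (P (c i)) - P (c (i + 1))‖ = ‖P (T (c i)) - P (c (i + 1))‖ := by rw [hPT]
    _ ≤ K * ‖T (c i) - c (i + 1)‖ := hP _ _
    _ < K * δ := by gcongr; exact hc i hi
    _ ≤ ε := hδ

/-- A chain recurrent system semiconjugates, along a linear map, to a chain recurrent one. -/
theorem ChainRecurrent.map {𝕜 E F : Type*} [NontriviallyNormedField 𝕜] [NormedAddCommGroup E]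
    [NormedSpace 𝕜 E] [NormedAddCommGroup F] [NormedSpace 𝕜 F] {T : E → E} {S : F → F}
    (P : E →L[𝕜] F) (hPT : ∀ x, P (T x) = S (P x)) {x : E} (h : ChainRecurrent T x) :
    ChainRecurrent S (P x) := by
  intro ε hε
  have hK : 0 < ‖P‖ + 1 := by positivity
  refine EpsChain.map hK (mul_div_cancel₀ ε hK.ne').le (fun x y => ?_) hPT (h _ (div_pos hε hK))
  rw [← map_sub]
  exact (P.le_opNorm _).trans (by gcongr; linarith)

/-- A closed `ε`-chain can be repeated forever. -/
theorem EpsChain.exists_periodic {E : Type*} [NormedAddCommGroup E] {T : E → E} {ε : ℝ} {x : E}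
    (h : EpsChain T ε x x) :
    ∃ (n : ℕ) (c : ℕ → E), 1 ≤ n ∧ (∀ k, n ∣ k → c k = x) ∧
      ∀ i, ‖T (c i) - c (i + 1)‖ < ε := by
  obtain ⟨n, c, hn, h0, hcn, hc⟩ := h
  refine ⟨n, fun i => c (i % n), hn, fun k hk => ?_, fun i => ?_⟩
  · simp [Nat.mod_eq_zero_of_dvd hk, h0]
  · have hi : i % n < n := Nat.mod_lt _ hn
    have key : c ((i + 1) % n) = c (i % n + 1) := by
      rw [← Nat.mod_add_mod]
      rcases Nat.lt_or_eq_of_le (Nat.succ_le_of_lt hi) with h | h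
      · rw [Nat.mod_eq_of_lt h]
      · rw [Nat.succ_eq_add_one] at h
        rw [h, Nat.mod_self, h0, hcn]
    simpa only [key] using hc _ hi

theorem ChainRecurrent.add {E : Type*} [NormedAddCommGroup E] {T : E → E}
    (hT : ∀ x y, T (x + y) = T x + T y) {x y : E} (hx : ChainRecurrent T x)
    (hy : ChainRecurrent T y) : ChainRecurrent T (x + y) := by
  intro ε hε
  obtain ⟨p, c, hp, hcp, hc⟩ := (hx _ (half_pos hε)).exists_periodic
  obtain ⟨q, d, hq, hdq, hd⟩ := (hy _ (half_pos hε)).exists_periodic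
  refine ⟨p * q, fun i => c i + d i, Nat.mul_pos hp hq, ?_, ?_, fun i _ => ?_⟩
  · simp only [hcp 0 (dvd_zero p), hdq 0 (dvd_zero q)]
  · simp only [hcp _ (dvd_mul_right p q), hdq _ (dvd_mul_left q p)]
  · simp only [hT]
    rw [add_sub_add_comm]
    exact (norm_add_le _ _).trans_lt (by linarith [hc i, hd i])

/-- The projection onto `M` along `N` commutes with a map leaving both invariant. -/
theorem Submodule.projectionOnto_map_of_invariant {R E : Type*} [Ring R] [AddCommGroup E]
    [Module R E] {M N : Submodule R E} (h : IsCompl M N) (T : E →ₗ[R] E)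
    (hM : ∀ x ∈ M, T x ∈ M) (hN : ∀ x ∈ N, T x ∈ N) (x : E) :
    M.projectionOnto N h (T x) =
      ⟨T (M.projectionOnto N h x), hM _ (M.projectionOnto N h x).2⟩ := by
  obtain ⟨m, hm, n, hn, rfl⟩ := Submodule.mem_sup.1 (h.sup_eq_top ▸ Submodule.mem_top (x := x))
  have h1 := M.projectionOnto_apply_left h ⟨m, hm⟩
  have h2 := (M.projectionOnto_apply_eq_zero_iff h).2 hn
  have h3 := M.projectionOnto_apply_left h ⟨T m, hM m hm⟩
  have h4 := (M.projectionOnto_apply_eq_zero_iff h).2 (hN n hn)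
  simp only [map_add, h2, h4, add_zero] at *
  simp only [h1, h3]

/-- Chain transitivity passes to an invariant summand of a topological decomposition. -/
theorem ChainRecurrent.restrict_of_isTopCompl {𝕜 X : Type*} [NontriviallyNormedField 𝕜]
    [NormedAddCommGroup X] [NormedSpace 𝕜 X] (T : X →L[𝕜] X) {M N : Submodule 𝕜 X}
    (h : M.IsTopCompl N) (hM : ∀ x ∈ M, T x ∈ M) (hN : ∀ x ∈ N, T x ∈ N) (m : M)
    (hm : ChainRecurrent T (m : X)) :
    ChainRecurrent (fun a : M => (⟨T a, hM a a.2⟩ : M)) m := by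
  have := hm.map (S := fun a : M => (⟨T a, hM a a.2⟩ : M)) (M.projectionOntoL N h) fun x => by
    simpa using Submodule.projectionOnto_map_of_invariant h.isCompl (T : X →ₗ[𝕜] X) hM hN x
  rwa [Submodule.projectionOntoL_apply_left] at this

theorem stmt_12 {𝕜 : Type*} [RCLike 𝕜] {X : Type*} [NormedAddCommGroup X] [NormedSpace 𝕜 X]
    [CompleteSpace X] (T : X →L[𝕜] X) (M N : Submodule 𝕜 X)
    (hMc : IsClosed (M : Set X)) (hNc : IsClosed (N : Set X))
    (hMi : ∀ x ∈ M, T x ∈ M) (hNi : ∀ x ∈ N, T x ∈ N)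
    (hcompl : IsCompl M N) :
    (∀ x : X, ChainRecurrent (⇑T) x) ↔
      (∀ m : M, ChainRecurrent (fun a : M => (⟨T a, hMi a a.2⟩ : M)) m) ∧
      (∀ n : N, ChainRecurrent (fun b : N => (⟨T b, hNi b b.2⟩ : N)) n) := by
  have h : M.IsTopCompl N := Submodule.IsCompl.isTopCompl_of_isClosed hcompl hMc hNc
  refine ⟨fun H => ⟨fun m => ?_, fun n => ?_⟩, fun ⟨HM, HN⟩ x => ?_⟩
  · exact (H m).restrict_of_isTopCompl T h hMi hNi m
  · exact (H n).restrict_of_isTopCompl T h.symm hNi hMi n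
  · obtain ⟨m, hm, n, hn, rfl⟩ :=
      Submodule.mem_sup.1 (hcompl.sup_eq_top ▸ Submodule.mem_top (x := x))
    exact ((HM ⟨m, hm⟩).map M.subtypeL fun _ => rfl).add (map_add T)
      ((HN ⟨n, hn⟩).map N.subtypeL fun _ => rfl)
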